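/- Let d ≥ 3 and let q > 1 be a real number; set 2* = 2d/(d−2). There exists ε > 0, depending only on d and q, such that the following holds for every κ ∈ ℝ with |κ| ≤ 1. Let u₁, u₂ : ℝ^d → ℝ be continuously differentiable on Ω = {x : ‖x‖ ≥ 1}, each with ∫_Ω |∇u_i|² dx < ∞ and ∫_Ω |u_i|^{2*} dx < ∞, and each satisfying the weak formulation: for every smooth compactly supported φ : ℝ^d → ℝ with support contained in {x : ‖x‖ > 1}, ∫_Ω ∇u_i·∇φ dx + κ ∫_Ω |u_i|^{q−1} u_i φ dx = 0. Suppose u₁(x) = u₂(x) for every x with ‖x‖ = 1, that the difference is approximable by test functions in the homogeneous Sobolev seminorm: for every δ > 0 there is a smooth compactly supported φ with support in {‖x‖ > 1} such that ∫_Ω |∇(u₁ − u₂ − φ)|² dx < δ, and that ‖u₁‖_{L^{d(q−1)/2}(Ω)} + ‖u₂‖_{L^{d(q−1)/2}(Ω)} ≤ ε. Then u₁ = u₂ on Ω. -/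

import Mathlib

open MeasureTheory

/-- The pointwise scalar product `∇u(x)·∇φ(x)` of the gradients of two real-valued functions
on `ℝ^d`. -/
noncomputable def gradDot (d : ℕ) (u φ : EuclideanSpace ℝ (Fin d) → ℝ)
    (x : EuclideanSpace ℝ (Fin d)) : ℝ :=
  ∑ a : Fin d, fderiv ℝ u x (EuclideanSpace.single a 1) * fderiv ℝ φ x (EuclideanSpace.single a 1)

/-- The squared Euclidean norm `|∇u(x)|²` of the gradient of a real-valued function on `ℝ^d`. -/
noncomputable def gradNormSq (d : ℕ) (u : EuclideanSpace ℝ (Fin d) → ℝ)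
    (x : EuclideanSpace ℝ (Fin d)) : ℝ :=
  ∑ a : Fin d, fderiv ℝ u x (EuclideanSpace.single a 1) ^ 2

open scoped NNReal ENNReal Topology
open Filter

lemma gradNormSq_nonneg (d : ℕ) (u : EuclideanSpace ℝ (Fin d) → ℝ) (x) : 0 ≤ gradNormSq d u x :=
  Finset.sum_nonneg fun _ _ => sq_nonneg _

lemma fderiv_sq_le (d : ℕ) (u : EuclideanSpace ℝ (Fin d) → ℝ) (x) :
    ‖fderiv ℝ u x‖ ^ 2 ≤ gradNormSq d u x := by
  have h : ‖fderiv ℝ u x‖ ≤ √(gradNormSq d u x) := by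
    refine ContinuousLinearMap.opNorm_le_bound _ (Real.sqrt_nonneg _) fun v => ?_
    have e : fderiv ℝ u x v = ∑ a, fderiv ℝ u x (EuclideanSpace.single a 1) * v a := by
      have hv : v = ∑ a, v a • EuclideanSpace.single a (1:ℝ) := by
        ext i
        simp [Finset.sum_apply, Pi.single_apply]
      conv_lhs => rw [hv]
      simp [mul_comm]
    rw [e, EuclideanSpace.norm_eq, Real.norm_eq_abs]
    refine (Real.abs_le_sqrt (y := (∑ a, fderiv ℝ u x (EuclideanSpace.single a 1) ^ 2) * ∑ a, v a ^ 2) ?_).trans ?_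
    · exact Finset.sum_mul_sq_le_sq_mul_sq _ _ _
    · rw [Real.sqrt_mul (Finset.sum_nonneg fun _ _ => sq_nonneg _)]
      simp [gradNormSq]
  calc ‖fderiv ℝ u x‖ ^ 2 ≤ √(gradNormSq d u x) ^ 2 := by gcongr
    _ = _ := Real.sq_sqrt (gradNormSq_nonneg d u x)

lemma eLp_fderiv_le (d : ℕ) (u : EuclideanSpace ℝ (Fin d) → ℝ) (μ : Measure (EuclideanSpace ℝ (Fin d)))
    (h : Integrable (fun x => gradNormSq d u x) μ) :
    eLpNorm (fderiv ℝ u) 2 μ ≤ ENNReal.ofReal √(∫ x, gradNormSq d u x ∂μ) := by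
  rw [eLpNorm_eq_lintegral_rpow_enorm_toReal (by norm_num) (by norm_num), Real.sqrt_eq_rpow,
    ← ENNReal.ofReal_rpow_of_nonneg (integral_nonneg (gradNormSq_nonneg d u)) (by norm_num),
    ofReal_integral_eq_lintegral_ofReal h (Eventually.of_forall (gradNormSq_nonneg d u))]
  simp only [ENNReal.toReal_ofNat]
  gcongr with x
  rw [← ofReal_norm, ENNReal.ofReal_rpow_of_nonneg (norm_nonneg _) (by norm_num)]
  refine ENNReal.ofReal_le_ofReal ?_
  simpa using fderiv_sq_le d u x

lemma memLp_comp (d : ℕ) (u : EuclideanSpace ℝ (Fin d) → ℝ) (μ : Measure (EuclideanSpace ℝ (Fin d)))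
    (h : Integrable (fun x => gradNormSq d u x) μ) (a : Fin d) :
    MemLp (fun x => fderiv ℝ u x (EuclideanSpace.single a 1)) 2 μ := by
  have hm : Measurable (fun x => fderiv ℝ u x (EuclideanSpace.single a (1:ℝ))) :=
    measurable_fderiv_apply_const ℝ u _
  rw [memLp_two_iff_integrable_sq hm.aestronglyMeasurable]
  refine h.mono (hm.pow_const 2).aestronglyMeasurable (Eventually.of_forall fun x => ?_)
  rw [Real.norm_of_nonneg (sq_nonneg _), Real.norm_of_nonneg (gradNormSq_nonneg d u x)]
  exact Finset.single_le_sum (f := fun a => fderiv ℝ u x (EuclideanSpace.single a 1) ^ 2)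
    (fun _ _ => sq_nonneg _) (Finset.mem_univ a)

lemma int_dot (d : ℕ) (u v : EuclideanSpace ℝ (Fin d) → ℝ) (μ : Measure (EuclideanSpace ℝ (Fin d)))
    (hu : ∀ a, MemLp (fun x => fderiv ℝ u x (EuclideanSpace.single a 1)) 2 μ)
    (hv : ∀ a, MemLp (fun x => fderiv ℝ v x (EuclideanSpace.single a 1)) 2 μ) :
    Integrable (fun x => gradDot d u v x) μ :=
  integrable_finsetSum _ fun a _ => (hu a).integrable_mul (hv a)

lemma dot_self (d : ℕ) (u : EuclideanSpace ℝ (Fin d) → ℝ) : gradNormSq d u = gradDot d u u := by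
  ext x; simp [gradNormSq, gradDot, sq]

lemma int_normSq (d : ℕ) (u : EuclideanSpace ℝ (Fin d) → ℝ) (μ : Measure (EuclideanSpace ℝ (Fin d)))
    (hu : ∀ a, MemLp (fun x => fderiv ℝ u x (EuclideanSpace.single a 1)) 2 μ) :
    Integrable (fun x => gradNormSq d u x) μ := by
  rw [dot_self]; exact int_dot d u u μ hu hu

lemma eLp_pow (d : ℕ) (hd : 3 ≤ d) (q : ℝ) (hq : 1 < q) {E : Type*} [MeasurableSpace E] (μ : Measure E)
    (u : E → ℝ) (η : ℝ) (hη : 0 < η)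
    (hi : Integrable (fun x => |u x| ^ ((d : ℝ) * (q - 1) / 2)) μ)
    (h : (∫ x, |u x| ^ ((d : ℝ) * (q - 1) / 2) ∂μ) ^ (2 / ((d : ℝ) * (q - 1))) ≤ η ^ (1 / (q - 1))) :
    eLpNorm (fun x => |u x| ^ (q-1)) (ENNReal.ofReal (d/2)) μ ≤ ENNReal.ofReal η := by
  have hd0 : (0:ℝ) < d := by positivity
  have hq0 : 0 < q - 1 := by linarith
  have hI : 0 ≤ ∫ x, |u x| ^ ((d : ℝ) * (q - 1) / 2) ∂μ := integral_nonneg fun x => by positivity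
  have hdd : ENNReal.ofReal ((d:ℝ)/2) ≠ 0 := by simp; omega
  rw [eLpNorm_eq_lintegral_rpow_enorm_toReal hdd ENNReal.ofReal_ne_top,
    ENNReal.toReal_ofReal (by positivity)]
  have e : ∫⁻ x, ‖|u x| ^ (q-1)‖ₑ ^ ((d:ℝ)/2) ∂μ = ENNReal.ofReal (∫ x, |u x| ^ ((d : ℝ) * (q - 1) / 2) ∂μ) := by
    rw [ofReal_integral_eq_lintegral_ofReal hi (Eventually.of_forall fun x => by positivity)]
    refine lintegral_congr fun x => ?_
    rw [Real.enorm_of_nonneg (by positivity), ENNReal.ofReal_rpow_of_nonneg (by positivity) (by positivity),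
      ← Real.rpow_mul (abs_nonneg _)]
    congr 2; ring
  rw [e, ENNReal.ofReal_rpow_of_nonneg hI (by positivity)]
  refine ENNReal.ofReal_le_ofReal ?_
  have h2 := Real.rpow_le_rpow (by positivity) h hq0.le
  rw [← Real.rpow_mul hI, ← Real.rpow_mul hη.le, one_div_mul_cancel hq0.ne', Real.rpow_one] at h2
  convert h2 using 2
  field_simp

lemma holder3 (d : ℕ) (hd : 3 ≤ d) {E : Type*} [MeasurableSpace E] (μ : Measure E)
    (p' : ℝ≥0) (hp' : (p':ℝ) = 2 * (d : ℝ) / ((d : ℝ) - 2)) (f g h : E → ℝ)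
    (hf : AEStronglyMeasurable f μ) (hg : AEStronglyMeasurable g μ) (hh : AEStronglyMeasurable h μ) :
    eLpNorm (fun x => f x * (g x * h x)) 1 μ ≤
      eLpNorm f (ENNReal.ofReal (d/2)) μ * (eLpNorm g p' μ * eLpNorm h p' μ) := by
  have hd0 : (3:ℝ) ≤ d := by exact_mod_cast hd
  have hd2 : (0:ℝ) < d - 2 := by linarith
  have ep : (p' : ℝ≥0∞) = ENNReal.ofReal (2 * (d : ℝ) / ((d : ℝ) - 2)) := by
    rw [← hp', ENNReal.ofReal_coe_nnreal]
  rw [ep]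
  have t1 : ENNReal.HolderTriple (ENNReal.ofReal (2 * (d : ℝ) / ((d : ℝ) - 2)))
      (ENNReal.ofReal (2 * (d : ℝ) / ((d : ℝ) - 2))) (ENNReal.ofReal ((d:ℝ) / (d - 2))) := by
    constructor
    rw [← ENNReal.ofReal_inv_of_pos (by positivity), ← ENNReal.ofReal_inv_of_pos (by positivity),
      ← ENNReal.ofReal_add (by positivity) (by positivity)]
    congr 1; field_simp; ring
  have t2 : ENNReal.HolderTriple (ENNReal.ofReal ((d : ℝ) / 2)) (ENNReal.ofReal ((d:ℝ) / (d - 2))) 1 := by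
    constructor
    rw [← ENNReal.ofReal_inv_of_pos (by positivity), ← ENNReal.ofReal_inv_of_pos (by positivity),
      ← ENNReal.ofReal_add (by positivity) (by positivity), inv_one, ← ENNReal.ofReal_one]
    congr 1; field_simp; ring
  refine (eLpNorm_smul_le_mul_eLpNorm (f := fun x => g x * h x) (φ := f) (hg.mul hh) hf
    (p := ENNReal.ofReal (d/2)) (q := ENNReal.ofReal ((d:ℝ) / (d - 2)))).trans ?_
  gcongr
  exact eLpNorm_smul_le_mul_eLpNorm (f := h) (φ := g) hh hg

lemma sobA {E : Type*} [NormedAddCommGroup E] [InnerProductSpace ℝ E] [MeasurableSpace E] [BorelSpace E]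
    [FiniteDimensional ℝ E] (μ : Measure E) [μ.IsAddHaarMeasure] (hn : 0 < Module.finrank ℝ E)
    (p' : ℝ≥0) (hp' : (p' : ℝ)⁻¹ = ((2:ℝ≥0):ℝ)⁻¹ - (Module.finrank ℝ E : ℝ)⁻¹)
    (v : E → ℝ) (hv : ContDiff ℝ 1 v) (hv2 : eLpNorm v 2 μ ≠ ⊤) :
    eLpNorm v p' μ ≤ eLpNormLESNormFDerivOfEqInnerConst μ (2:ℝ≥0) * eLpNorm (fderiv ℝ v) 2 μ := by
  let χ : ContDiffBump (0:E) := ⟨1, 2, by norm_num, by norm_num⟩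
  have hχ : ContDiff ℝ 1 χ := χ.contDiff
  obtain ⟨M, hM⟩ : ∃ M : ℝ, ∀ x, ‖fderiv ℝ χ x‖ ≤ M := by
    have h1 : Continuous (fderiv ℝ χ) := hχ.continuous_fderiv (by norm_num)
    exact (χ.hasCompactSupport.fderiv ℝ).exists_bound_of_continuous h1
  have hM0 : 0 ≤ M := (norm_nonneg _).trans (hM 0)
  let c : ℕ → ℝ := fun n => 1 / ((n:ℝ) + 1)
  have hc0 : ∀ n, 0 < c n := fun n => by positivity
  have hc : Tendsto c atTop (𝓝 0) := tendsto_one_div_add_atTop_nhds_zero_nat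
  let X : ℕ → E → ℝ := fun n x => χ (c n • x)
  have hX : ∀ n, ContDiff ℝ 1 (X n) := fun n => hχ.comp (contDiff_const_smul (c n))
  have hXs : ∀ n, HasCompactSupport (X n) := fun n =>
    χ.hasCompactSupport.comp_homeomorph (Homeomorph.smulOfNeZero (c n) (hc0 n).ne')
  have hXd : ∀ n x, ‖fderiv ℝ (X n) x‖ ≤ c n * M := by
    intro n x
    have : HasFDerivAt (X n) ((fderiv ℝ χ (c n • x)).comp (c n • ContinuousLinearMap.id ℝ E)) x := by
      have h1 : HasFDerivAt χ (fderiv ℝ χ (c n • x)) (c n • x) :=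
        (hχ.differentiable (by norm_num) _).hasFDerivAt
      have h2 : HasFDerivAt (fun y : E => c n • y) (c n • ContinuousLinearMap.id ℝ E) x :=
        (hasFDerivAt_id x).const_smul (c n)
      exact HasFDerivAt.comp (g := χ) x h1 h2
    rw [this.fderiv, ContinuousLinearMap.comp_smul, ContinuousLinearMap.comp_id, norm_smul,
      Real.norm_of_nonneg (hc0 n).le]
    exact mul_le_mul_of_nonneg_left (hM _) (hc0 n).le
  let f : ℕ → E → ℝ := fun n x => X n x * v x
  have hf : ∀ n, ContDiff ℝ 1 (f n) := fun n => (hX n).mul hv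
  have hlim : ∀ x, Tendsto (fun n => f n x) atTop (𝓝 (v x)) := by
    intro x
    have h1 : Tendsto (fun n => χ (c n • x)) atTop (𝓝 (χ 0)) := by
      have h2 : Tendsto (fun n => c n • x) atTop (𝓝 ((0:ℝ) • x)) := hc.smul_const x
      rw [zero_smul] at h2
      exact (χ.continuous.tendsto 0).comp h2
    have h3 : χ 0 = 1 := χ.one_of_mem_closedBall (by simp [χ])
    rw [h3] at h1
    simpa using h1.mul_const (v x)
  have hb : ∀ n, eLpNorm (f n) p' μ ≤ eLpNormLESNormFDerivOfEqInnerConst μ (2:ℝ≥0) *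
      (eLpNorm (fderiv ℝ v) 2 μ + ENNReal.ofReal (c n * M) * eLpNorm v 2 μ) := by
    intro n
    refine (eLpNorm_le_eLpNorm_fderiv_of_eq_inner μ (hf n) ((hXs n).mul_right) (p := 2) (by norm_num) hn hp').trans ?_
    gcongr
    have h1 : ∀ x, ‖fderiv ℝ (f n) x‖ ≤ ‖(‖fderiv ℝ v x‖ + (c n * M) • ‖v x‖)‖ := by
      intro x
      have := fderiv_fun_mul ((hX n).differentiable (by norm_num) x) (hv.differentiable (by norm_num) x)
      simp only [f]
      rw [this, Real.norm_of_nonneg (by have := hc0 n; positivity)]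
      refine (norm_add_le _ _).trans ?_
      rw [norm_smul, norm_smul]
      have h2 : ‖X n x‖ ≤ 1 := by
        rw [Real.norm_of_nonneg χ.nonneg]; exact χ.le_one
      have := hXd n x
      rw [smul_eq_mul]
      nlinarith [norm_nonneg (v x), norm_nonneg (fderiv ℝ v x)]
    calc eLpNorm (fderiv ℝ (f n)) 2 μ ≤ eLpNorm (fun x => ‖fderiv ℝ v x‖ + (c n * M) • ‖v x‖) 2 μ := eLpNorm_mono h1
      _ ≤ eLpNorm (fun x => ‖fderiv ℝ v x‖) 2 μ + eLpNorm ((c n * M) • fun x => ‖v x‖) 2 μ :=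
          eLpNorm_add_le (hv.continuous_fderiv (by norm_num)).norm.aestronglyMeasurable
            (Continuous.aestronglyMeasurable (by have := hv.continuous; fun_prop)) (by norm_num)
      _ = _ := by
        rw [eLpNorm_const_smul, eLpNorm_norm, eLpNorm_norm, Real.enorm_of_nonneg (by have := hc0 n; positivity)]
  refine (Lp.eLpNorm_lim_le_liminf_eLpNorm (f := f) (fun n => (hf n).continuous.aestronglyMeasurable) v
    (Eventually.of_forall hlim)).trans ?_
  refine (liminf_le_liminf (Eventually.of_forall hb)).trans ?_
  refine le_of_eq (Tendsto.liminf_eq ?_)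
  refine ENNReal.Tendsto.const_mul ?_ (Or.inr ENNReal.coe_ne_top)
  have : Tendsto (fun n => ENNReal.ofReal (c n * M) * eLpNorm v 2 μ) atTop (𝓝 (ENNReal.ofReal (0 * M) * eLpNorm v 2 μ)) :=
    ENNReal.Tendsto.mul_const (ENNReal.tendsto_ofReal (hc.mul_const M)) (Or.inr hv2)
  simpa using tendsto_const_nhds.add this

lemma Nlip (q : ℝ) (hq : 1 < q) (a b : ℝ) :
    |(|a| ^ (q-1) * a - |b| ^ (q-1) * b)| ≤ q * (|a|^(q-1) + |b|^(q-1)) * |a - b| := by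
  wlog h : |b| ≤ |a| generalizing a b
  · have := this b a (le_of_not_ge h)
    rw [abs_sub_comm, abs_sub_comm a b, add_comm]; exact this
  have ha := Real.rpow_nonneg (abs_nonneg a) (q-1)
  have hb := Real.rpow_nonneg (abs_nonneg b) (q-1)
  have hle : |b|^(q-1) ≤ |a|^(q-1) := Real.rpow_le_rpow (abs_nonneg b) h (by linarith)
  have key : (|a|^(q-1) - |b|^(q-1)) * |b| ≤ (q-1) * |a|^(q-1) * (|a| - |b|) := by
    rcases eq_or_lt_of_le (abs_nonneg a) with h0 | h0
    · have : |b| = 0 := le_antisymm (by linarith) (abs_nonneg b)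
      rw [this, ← h0]; simp
    · have hB0 : 0 ≤ |b|/|a| := by positivity
      have hB := one_add_mul_self_le_rpow_one_add (s := |b|/|a| - 1) (by linarith) hq.le
      rw [show 1 + (|b|/|a| - 1) = |b|/|a| by ring, Real.div_rpow (abs_nonneg b) h0.le] at hB
      have e1 : |a|^q = |a|^(q-1) * |a| := by
        rw [← Real.rpow_add_one h0.ne']; ring_nf
      have e2 : |b|^q = |b|^(q-1) * |b| := by
        rw [← Real.rpow_add_one' (abs_nonneg b) (by linarith)]; ring_nf
      have hp : 0 < |a|^(q-1) := Real.rpow_pos_of_pos h0 _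
      rw [e1, e2, le_div_iff₀ (by positivity)] at hB
      have e3 : (1 + q * (|b| / |a| - 1)) * (|a| ^ (q - 1) * |a|) = |a|^(q-1) * (|a| + q * (|b| - |a|)) := by
        field_simp
      rw [e3] at hB
      nlinarith
  have h2 : |a| - |b| ≤ |a - b| := abs_sub_abs_le_abs_sub a b
  calc |(|a| ^ (q-1) * a - |b| ^ (q-1) * b)| = |(|a|^(q-1) * (a - b) + (|a|^(q-1) - |b|^(q-1)) * b)| := by ring_nf
    _ ≤ |a|^(q-1) * |a - b| + (|a|^(q-1) - |b|^(q-1)) * |b| := by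
      refine (abs_add_le _ _).trans ?_
      rw [abs_mul, abs_mul, abs_of_nonneg ha, abs_of_nonneg (sub_nonneg.2 hle)]
    _ ≤ |a|^(q-1) * |a - b| + (q-1) * |a|^(q-1) * |a - b| := by
      have : 0 ≤ (q-1) * |a|^(q-1) := mul_nonneg (by linarith) ha
      nlinarith
    _ ≤ _ := by
      have : 0 ≤ q * |b|^(q-1) * |a-b| := by positivity
      nlinarith

lemma truncF : ∃ F : ℕ → ℝ → ℝ, (∀ n, ContDiff ℝ 1 (F n)) ∧ (∀ n t, |deriv (F n) t| ≤ 1) ∧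
    (∀ n t, |F n t| ≤ |t|) ∧ (∀ (n : ℕ) t, |t| ≤ 1 / ((n:ℝ)+1) → F n t = 0) ∧
    (∀ t, Tendsto (fun n => F n t) atTop (𝓝 t)) := by
  let g : ℕ → ℝ → ℝ := fun n s => min 1 (max 0 (((n:ℝ)+1) * |s| - 1))
  have hg : ∀ n, Continuous (g n) := fun n => by fun_prop
  have hg0 : ∀ n s, 0 ≤ g n s := fun n s => le_min zero_le_one (le_max_left _ _)
  have hg1 : ∀ n s, g n s ≤ 1 := fun n s => min_le_left _ _
  have hgn : ∀ n s, ‖g n s‖ ≤ 1 := fun n s => by rw [Real.norm_of_nonneg (hg0 n s)]; exact hg1 n s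
  have hd : ∀ n t, HasDerivAt (fun t => ∫ s in (0:ℝ)..t, g n s) (g n t) t := fun n t =>
    intervalIntegral.integral_hasDerivAt_right ((hg n).intervalIntegrable _ _)
      ((hg n).stronglyMeasurableAtFilter _ _) (hg n).continuousAt
  refine ⟨fun n t => ∫ s in (0:ℝ)..t, g n s, ?_, ?_, ?_, ?_, ?_⟩
  · intro n
    rw [contDiff_one_iff_deriv]
    refine ⟨fun t => (hd n t).differentiableAt, ?_⟩
    have : deriv (fun t => ∫ s in (0:ℝ)..t, g n s) = g n := funext fun t => (hd n t).deriv
    rw [this]; exact hg n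
  · intro n t
    rw [(hd n t).deriv]; exact hgn n t
  · intro n t
    have := intervalIntegral.norm_integral_le_of_norm_le_const (a := 0) (b := t) (C := 1) (f := g n) (fun x _ => hgn n x)
    simpa using this
  · intro n t ht
    have : ∫ s in (0:ℝ)..t, g n s = ∫ s in (0:ℝ)..t, (0:ℝ) := by
      refine intervalIntegral.integral_congr fun s hs => ?_
      have hs' : |s| ≤ |t| := by
        have := Set.abs_sub_left_of_mem_uIcc hs
        simpa using this
      have h2 : ((n:ℝ)+1) * |s| ≤ 1 := by
        have := hs'.trans ht
        rwa [le_div_iff₀ (by positivity), mul_comm] at this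
      simp only [g]
      rw [max_eq_left (by linarith)]; simp
    simpa using this
  · intro t
    have : Tendsto (fun n => ∫ s in (0:ℝ)..t, g n s) atTop (𝓝 (∫ s in (0:ℝ)..t, (1:ℝ))) := by
      refine intervalIntegral.tendsto_integral_filter_of_dominated_convergence (fun _ => 1)
        (Eventually.of_forall fun n => (hg n).aestronglyMeasurable)
        (Eventually.of_forall fun n => Eventually.of_forall fun x _ => hgn n x) (by simp) ?_
      have h0 : ∀ᵐ x : ℝ, x ≠ 0 := by simp [ae_iff]
      filter_upwards [h0] with x hx _
      refine tendsto_const_nhds.congr' ?_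
      have : Tendsto (fun n : ℕ => ((n:ℝ)+1) * |x|) atTop atTop :=
        (tendsto_atTop_add_const_right _ _ tendsto_natCast_atTop_atTop).atTop_mul_const (abs_pos.2 hx)
      filter_upwards [this.eventually_ge_atTop 2] with n hn
      simp only [g]
      rw [max_eq_right (by linarith), min_eq_left (by linarith)]
    simpa using this

lemma sobB {E : Type*} [NormedAddCommGroup E] [InnerProductSpace ℝ E] [MeasurableSpace E] [BorelSpace E]
    [FiniteDimensional ℝ E] (μ : Measure E) [μ.IsAddHaarMeasure] (hn : 0 < Module.finrank ℝ E)
    (p' : ℝ≥0) (hp' : (p' : ℝ)⁻¹ = ((2:ℝ≥0):ℝ)⁻¹ - (Module.finrank ℝ E : ℝ)⁻¹) (hp2 : 2 ≤ p')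
    (w : E → ℝ) (hw : ContDiffOn ℝ 1 w {x | 1 ≤ ‖x‖}) (hw0 : ∀ x, ‖x‖ = 1 → w x = 0)
    (hwi : IntegrableOn (fun x => |w x| ^ (p':ℝ)) {x | 1 ≤ ‖x‖} μ) :
    eLpNorm w p' (μ.restrict {x | 1 ≤ ‖x‖}) ≤ eLpNormLESNormFDerivOfEqInnerConst μ (2:ℝ≥0) *
      eLpNorm (fderiv ℝ w) 2 (μ.restrict {x | 1 ≤ ‖x‖}) := by
  classical
  obtain ⟨F, hF1, hFd, hFle, hF0, hFl⟩ := truncF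
  have hΩ : MeasurableSet {x : E | 1 ≤ ‖x‖} := measurableSet_le measurable_const measurable_norm
  let v : ℕ → E → ℝ := fun n x => if 1 ≤ ‖x‖ then F n (w x) else 0
  have hvind : ∀ n, v n = Set.indicator {x | 1 ≤ ‖x‖} (fun x => F n (w x)) := by
    intro n; ext x; simp [v, Set.indicator]
  have hnhd : ∀ x : E, 1 < ‖x‖ → {x : E | 1 ≤ ‖x‖} ∈ 𝓝 x := fun x hx =>
    mem_of_superset ((isOpen_lt continuous_const continuous_norm).mem_nhds hx) (fun y (hy : 1 < ‖y‖) => (hy.le : 1 ≤ ‖y‖))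
  have hin : ∀ n x, 1 < ‖x‖ → v n =ᶠ[𝓝 x] fun x => F n (w x) := by
    intro n x hx
    filter_upwards [hnhd x hx] with y hy
    exact if_pos hy
  have hout : ∀ n x, ‖x‖ ≤ 1 → v n =ᶠ[𝓝 x] fun _ => 0 := by
    intro n x hx
    rcases lt_or_eq_of_le hx with hx | hx
    · filter_upwards [(isOpen_lt continuous_norm continuous_const).mem_nhds hx] with y hy
      exact if_neg (not_le.2 hy)
    · have h1 : Tendsto w (𝓝[{x | 1 ≤ ‖x‖}] x) (𝓝 0) := by
        have := (hw.continuousOn x hx.ge)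
        rw [ContinuousWithinAt, hw0 x hx] at this; exact this
      have h2 : ∀ᶠ y in 𝓝[{x | 1 ≤ ‖x‖}] x, |w y| < 1 / ((n:ℝ)+1) := by
        have := h1.abs
        rw [abs_zero] at this
        exact this.eventually_lt_const (by positivity)
      rw [eventually_nhdsWithin_iff] at h2
      filter_upwards [h2] with y hy
      by_cases h : 1 ≤ ‖y‖
      · simp only [v, if_pos h]; exact hF0 n _ (hy h).le
      · exact if_neg h
  have hwat : ∀ x, 1 < ‖x‖ → ContDiffAt ℝ 1 w x := fun x hx => hw.contDiffAt (hnhd x hx)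
  have hv : ∀ n, ContDiff ℝ 1 (v n) := by
    intro n
    rw [contDiff_iff_contDiffAt]
    intro x
    rcases le_or_gt ‖x‖ 1 with hx | hx
    · exact contDiffAt_const.congr_of_eventuallyEq (hout n x hx)
    · exact ((hF1 n).contDiffAt.comp x (hwat x hx)).congr_of_eventuallyEq (hin n x hx)
  have hvd : ∀ n x, ‖fderiv ℝ (v n) x‖ ≤ ‖Set.indicator {x | 1 ≤ ‖x‖} (fderiv ℝ w) x‖ := by
    intro n x
    rcases le_or_gt ‖x‖ 1 with hx | hx
    · rw [(hout n x hx).fderiv_eq]; simp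
    · rw [(hin n x hx).fderiv_eq, Set.indicator_of_mem (by exact hx.le)]
      have := (((hF1 n).differentiable (by norm_num) (w x)).hasDerivAt.comp_hasFDerivAt x
        ((hwat x hx).differentiableAt (by norm_num)).hasFDerivAt).fderiv
      have e : (F n ∘ w) = fun x => F n (w x) := rfl
      rw [← e, this, norm_smul]
      exact mul_le_of_le_one_left (norm_nonneg _) (hFd n _)
  have hv2 : ∀ n, eLpNorm (v n) 2 μ ≠ ⊤ := by
    intro n
    set δ : ℝ := 1 / ((n:ℝ)+1)
    have hδ : 0 < δ := by positivity
    have hp2' : (2:ℝ) ≤ p' := by exact_mod_cast hp2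
    have hb : ∀ x, ‖v n x ^ 2‖ ≤ ‖δ ^ (2 - (p':ℝ)) * Set.indicator {x | 1 ≤ ‖x‖} (fun x => |w x| ^ (p':ℝ)) x‖ := by
      intro x
      by_cases hx : 1 ≤ ‖x‖
      · rw [Set.indicator_of_mem (by exact hx), Real.norm_of_nonneg (sq_nonneg _), Real.norm_of_nonneg (by positivity)]
        simp only [v, if_pos hx]
        rcases le_or_gt |w x| δ with h | h
        · rw [hF0 n _ h]; simp; positivity
        · have h0 : 0 < |w x| := hδ.trans h
          have h1 : |w x| ^ (2 - (p':ℝ)) ≤ δ ^ (2 - (p':ℝ)) :=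
            Real.rpow_le_rpow_of_nonpos hδ h.le (by linarith)
          calc F n (w x) ^ 2 ≤ |w x| ^ 2 := sq_le_sq.2 (by rw [abs_abs]; exact hFle n _)
            _ = |w x| ^ (2 - (p':ℝ)) * |w x| ^ (p':ℝ) := by
              rw [← Real.rpow_add h0]; simp
            _ ≤ _ := by gcongr
      · simp [v, hx]
    have hi : Integrable (fun x => v n x ^ 2) μ := by
      refine Integrable.mono ((hwi.integrable_indicator hΩ).const_mul (δ ^ (2 - (p':ℝ)))) ?_
        (Eventually.of_forall hb)
      exact ((hv n).continuous.pow 2).aestronglyMeasurable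
    exact ((memLp_two_iff_integrable_sq (hv n).continuous.aestronglyMeasurable).2 hi).2.ne
  have hb : ∀ n, eLpNorm (fun x => F n (w x)) p' (μ.restrict {x | 1 ≤ ‖x‖}) ≤
      eLpNormLESNormFDerivOfEqInnerConst μ (2:ℝ≥0) *
      eLpNorm (fderiv ℝ w) 2 (μ.restrict {x | 1 ≤ ‖x‖}) := by
    intro n
    rw [← eLpNorm_indicator_eq_eLpNorm_restrict hΩ, ← eLpNorm_indicator_eq_eLpNorm_restrict (f := fderiv ℝ w) hΩ, ← hvind]
    refine (sobA μ hn p' hp' (v n) (hv n) (hv2 n)).trans ?_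
    gcongr
    exact eLpNorm_mono (hvd n)
  have hm : ∀ n, AEStronglyMeasurable (fun x => F n (w x)) (μ.restrict {x | 1 ≤ ‖x‖}) := fun n =>
    ((hF1 n).continuous.comp_continuousOn hw.continuousOn).aestronglyMeasurable hΩ
  refine (Lp.eLpNorm_lim_le_liminf_eLpNorm hm w (Eventually.of_forall fun x => hFl (w x))).trans ?_
  refine (liminf_le_liminf (Eventually.of_forall hb)).trans ?_
  simp

lemma nl_est (d : ℕ) (hd : 3 ≤ d) (q : ℝ) (hq : 1 < q) (η : ℝ) (hη : 0 < η) {E : Type*} [MeasurableSpace E]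
    (μ : Measure E) (p' : ℝ≥0) (hp' : (p':ℝ) = 2 * (d : ℝ) / ((d : ℝ) - 2)) (C : ℝ≥0) (A B : ℝ)
    (hA : 0 ≤ A) (hB : 0 ≤ B)
    (u₁ u₂ φ : E → ℝ) (h1 : AEStronglyMeasurable u₁ μ) (h2 : AEStronglyMeasurable u₂ μ)
    (hφ : AEStronglyMeasurable φ μ)
    (hu1 : eLpNorm (fun x => |u₁ x| ^ (q-1)) (ENNReal.ofReal (d/2)) μ ≤ ENNReal.ofReal η)
    (hu2 : eLpNorm (fun x => |u₂ x| ^ (q-1)) (ENNReal.ofReal (d/2)) μ ≤ ENNReal.ofReal η)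
    (hw : eLpNorm (fun x => u₁ x - u₂ x) p' μ ≤ C * ENNReal.ofReal A)
    (hf : eLpNorm φ p' μ ≤ C * ENNReal.ofReal B) :
    |∫ x, (|u₁ x| ^ (q-1) * u₁ x - |u₂ x| ^ (q-1) * u₂ x) * φ x ∂μ| ≤ 2 * q * η * C ^ 2 * A * B := by
  have hm1 : AEStronglyMeasurable (fun x => |u₁ x| ^ (q-1)) μ :=
    ((Real.continuous_rpow_const (by linarith : 0 ≤ q - 1)).comp continuous_abs).comp_aestronglyMeasurable h1
  have hm2 : AEStronglyMeasurable (fun x => |u₂ x| ^ (q-1)) μ :=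
    ((Real.continuous_rpow_const (by linarith : 0 ≤ q - 1)).comp continuous_abs).comp_aestronglyMeasurable h2
  have hd0 : (3:ℝ) ≤ d := by exact_mod_cast hd
  have key : eLpNorm (fun x => (|u₁ x| ^ (q-1) * u₁ x - |u₂ x| ^ (q-1) * u₂ x) * φ x) 1 μ
      ≤ ENNReal.ofReal (2 * q * η * C ^ 2 * A * B) := by
    have hH1 := holder3 d hd μ p' hp' _ (fun x => u₁ x - u₂ x) φ hm1 (h1.sub h2) hφ
    have hH2 := holder3 d hd μ p' hp' _ (fun x => u₁ x - u₂ x) φ hm2 (h1.sub h2) hφ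
    have hb : ∀ u : E → ℝ, eLpNorm (fun x => |u x| ^ (q-1)) (ENNReal.ofReal (d/2)) μ ≤ ENNReal.ofReal η →
      eLpNorm (fun x => |u x| ^ (q-1)) (ENNReal.ofReal (d/2)) μ *
       (eLpNorm (fun x => u₁ x - u₂ x) p' μ * eLpNorm φ p' μ) ≤ ENNReal.ofReal (η * C^2 * A * B) := by
      intro u hu
      calc _ ≤ ENNReal.ofReal η * ((C * ENNReal.ofReal A) * (C * ENNReal.ofReal B)) := by gcongr
        _ = ENNReal.ofReal (η * C^2 * A * B) := by
          rw [← ENNReal.ofReal_coe_nnreal, ← ENNReal.ofReal_mul (by positivity), ← ENNReal.ofReal_mul (by positivity),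
            ← ENNReal.ofReal_mul (by positivity), ← ENNReal.ofReal_mul (by positivity)]
          congr 1; ring
    have hp : ∀ x, ‖(|u₁ x| ^ (q-1) * u₁ x - |u₂ x| ^ (q-1) * u₂ x) * φ x‖ ≤
        ‖(q • ((fun x => |u₁ x| ^ (q-1) * ((u₁ x - u₂ x) * φ x)) : E → ℝ) x)‖ +
        ‖(q • ((fun x => |u₂ x| ^ (q-1) * ((u₁ x - u₂ x) * φ x)) : E → ℝ) x)‖ := by
      intro x
      have := mul_le_mul_of_nonneg_right (Nlip q hq (u₁ x) (u₂ x)) (abs_nonneg (φ x))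
      have e1 := Real.rpow_nonneg (abs_nonneg (u₁ x)) (q-1)
      have e2 := Real.rpow_nonneg (abs_nonneg (u₂ x)) (q-1)
      simp only [Real.norm_eq_abs, smul_eq_mul, abs_mul, abs_of_nonneg e1, abs_of_nonneg e2,
        abs_of_pos (by linarith : 0 < q)] at this ⊢
      nlinarith
    have hm3 : ∀ u : E → ℝ, AEStronglyMeasurable (fun x => |u x| ^ (q-1)) μ → AEStronglyMeasurable (q • (fun x => |u x| ^ (q-1) * ((u₁ x - u₂ x) * φ x))) μ := by
      intro u hu
      exact (hu.mul ((h1.sub h2).mul hφ)).const_smul q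
    calc _ ≤ eLpNorm (fun x => ‖(q • ((fun x => |u₁ x| ^ (q-1) * ((u₁ x - u₂ x) * φ x)) : E → ℝ) x)‖ +
        ‖(q • ((fun x => |u₂ x| ^ (q-1) * ((u₁ x - u₂ x) * φ x)) : E → ℝ) x)‖) 1 μ := eLpNorm_mono_real hp
      _ ≤ eLpNorm (fun x => ‖(q • (fun x => |u₁ x| ^ (q-1) * ((u₁ x - u₂ x) * φ x)) : E → ℝ) x‖) 1 μ +
          eLpNorm (fun x => ‖(q • (fun x => |u₂ x| ^ (q-1) * ((u₁ x - u₂ x) * φ x)) : E → ℝ) x‖) 1 μ :=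
        eLpNorm_add_le (hm3 u₁ hm1).norm (hm3 u₂ hm2).norm le_rfl
      _ ≤ ENNReal.ofReal q * ENNReal.ofReal (η * C^2 * A * B) + ENNReal.ofReal q * ENNReal.ofReal (η * C^2 * A * B) := by
        rw [eLpNorm_norm, eLpNorm_norm, eLpNorm_const_smul, eLpNorm_const_smul, Real.enorm_of_nonneg (by linarith)]
        gcongr
        · exact hH1.trans (hb u₁ hu1)
        · exact hH2.trans (hb u₂ hu2)
      _ = _ := by
        have hq0 : 0 ≤ q := by linarith
        rw [← ENNReal.ofReal_mul hq0, ← ENNReal.ofReal_add (by positivity) (by positivity)]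
        congr 1; ring
  have hq0 : 0 ≤ q := by linarith
  have h3 := (enorm_integral_le_lintegral_enorm (μ := μ) (fun x => (|u₁ x| ^ (q-1) * u₁ x - |u₂ x| ^ (q-1) * u₂ x) * φ x))
  rw [← eLpNorm_one_eq_lintegral_enorm] at h3
  have h4 := h3.trans key
  rw [← ofReal_norm, ENNReal.ofReal_le_ofReal_iff (by positivity)] at h4
  exact h4

lemma fin_est (q : ℝ) (hq0 : 0 < q) (C : ℝ≥0) (a b : ℝ) (ha0 : 0 ≤ a) (hb0 : 0 ≤ b) :
    2 * q * (1 / (16 * q * ((C:ℝ) ^ 2 + 1))) * (C:ℝ) ^ 2 * √a * √b ≤ 1 / 8 * ((a + b) / 2) := by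
  have hK : 2 * q * (1 / (16 * q * ((C:ℝ) ^ 2 + 1))) * (C:ℝ) ^ 2 ≤ 1 / 8 := by
    have : 2 * q * (1 / (16 * q * ((C:ℝ) ^ 2 + 1))) * (C:ℝ) ^ 2 = (1/8) * ((C:ℝ) ^ 2 / ((C:ℝ) ^ 2 + 1)) := by
      field_simp; ring
    rw [this]
    have : (C:ℝ) ^ 2 / ((C:ℝ) ^ 2 + 1) ≤ 1 := by
      rw [div_le_one (by positivity)]; linarith
    linarith
  have hsq : √a * √b ≤ (a + b) / 2 := by
    nlinarith [sq_nonneg (√a - √b), Real.sq_sqrt ha0, Real.sq_sqrt hb0]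
  rw [mul_assoc (2 * q * (1 / (16 * q * ((C:ℝ) ^ 2 + 1))) * (C:ℝ) ^ 2)]
  exact mul_le_mul hK hsq (by positivity) (by norm_num)

set_option maxHeartbeats 2000000 in
theorem stmt15 (d : ℕ) (hd : 3 ≤ d) (q : ℝ) (hq : 1 < q) :
    ∃ ε : ℝ, 0 < ε ∧
    ∀ κ : ℝ, |κ| ≤ 1 →
    ∀ u₁ u₂ : EuclideanSpace ℝ (Fin d) → ℝ,
      ContDiffOn ℝ 1 u₁ {x : EuclideanSpace ℝ (Fin d) | 1 ≤ ‖x‖} →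
      ContDiffOn ℝ 1 u₂ {x : EuclideanSpace ℝ (Fin d) | 1 ≤ ‖x‖} →
      IntegrableOn (fun x => gradNormSq d u₁ x) {x : EuclideanSpace ℝ (Fin d) | 1 ≤ ‖x‖} volume →
      IntegrableOn (fun x => gradNormSq d u₂ x) {x : EuclideanSpace ℝ (Fin d) | 1 ≤ ‖x‖} volume →
      IntegrableOn (fun x => |u₁ x| ^ (2 * (d : ℝ) / ((d : ℝ) - 2)))
        {x : EuclideanSpace ℝ (Fin d) | 1 ≤ ‖x‖} volume →
      IntegrableOn (fun x => |u₂ x| ^ (2 * (d : ℝ) / ((d : ℝ) - 2)))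
        {x : EuclideanSpace ℝ (Fin d) | 1 ≤ ‖x‖} volume →
      (∀ φ : EuclideanSpace ℝ (Fin d) → ℝ,
        (∀ n : ℕ, ContDiff ℝ n φ) → HasCompactSupport φ →
        tsupport φ ⊆ {x : EuclideanSpace ℝ (Fin d) | 1 < ‖x‖} →
        (∫ x in {x : EuclideanSpace ℝ (Fin d) | 1 ≤ ‖x‖}, gradDot d u₁ φ x)
          + κ * ∫ x in {x : EuclideanSpace ℝ (Fin d) | 1 ≤ ‖x‖},
              |u₁ x| ^ (q - 1) * u₁ x * φ x = 0) →
      (∀ φ : EuclideanSpace ℝ (Fin d) → ℝ,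
        (∀ n : ℕ, ContDiff ℝ n φ) → HasCompactSupport φ →
        tsupport φ ⊆ {x : EuclideanSpace ℝ (Fin d) | 1 < ‖x‖} →
        (∫ x in {x : EuclideanSpace ℝ (Fin d) | 1 ≤ ‖x‖}, gradDot d u₂ φ x)
          + κ * ∫ x in {x : EuclideanSpace ℝ (Fin d) | 1 ≤ ‖x‖},
              |u₂ x| ^ (q - 1) * u₂ x * φ x = 0) →
      (∀ x : EuclideanSpace ℝ (Fin d), ‖x‖ = 1 → u₁ x = u₂ x) →
      (∀ δ : ℝ, 0 < δ → ∃ φ : EuclideanSpace ℝ (Fin d) → ℝ,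
        (∀ n : ℕ, ContDiff ℝ n φ) ∧ HasCompactSupport φ ∧
        tsupport φ ⊆ {x : EuclideanSpace ℝ (Fin d) | 1 < ‖x‖} ∧
        ∫ x in {x : EuclideanSpace ℝ (Fin d) | 1 ≤ ‖x‖},
            gradNormSq d (fun y => u₁ y - u₂ y - φ y) x < δ) →
      IntegrableOn (fun x => |u₁ x| ^ ((d : ℝ) * (q - 1) / 2))
        {x : EuclideanSpace ℝ (Fin d) | 1 ≤ ‖x‖} volume →
      IntegrableOn (fun x => |u₂ x| ^ ((d : ℝ) * (q - 1) / 2))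
        {x : EuclideanSpace ℝ (Fin d) | 1 ≤ ‖x‖} volume →
      (∫ x in {x : EuclideanSpace ℝ (Fin d) | 1 ≤ ‖x‖},
          |u₁ x| ^ ((d : ℝ) * (q - 1) / 2)) ^ (2 / ((d : ℝ) * (q - 1)))
        + (∫ x in {x : EuclideanSpace ℝ (Fin d) | 1 ≤ ‖x‖},
          |u₂ x| ^ ((d : ℝ) * (q - 1) / 2)) ^ (2 / ((d : ℝ) * (q - 1))) ≤ ε →
      ∀ x : EuclideanSpace ℝ (Fin d), 1 ≤ ‖x‖ → u₁ x = u₂ x := by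
  classical
  have hd0 : (3:ℝ) ≤ d := by exact_mod_cast hd
  have hd2 : (0:ℝ) < d - 2 := by linarith
  set C : ℝ≥0 := eLpNormLESNormFDerivOfEqInnerConst (volume : Measure (EuclideanSpace ℝ (Fin d))) (2:ℝ≥0) with hC
  let p' : ℝ≥0 := ⟨2 * (d : ℝ) / ((d : ℝ) - 2), by positivity⟩
  have hp' : (p':ℝ) = 2 * (d : ℝ) / ((d : ℝ) - 2) := rfl
  have hfin : Module.finrank ℝ (EuclideanSpace ℝ (Fin d)) = d := by simp
  have hn : 0 < Module.finrank ℝ (EuclideanSpace ℝ (Fin d)) := by rw [hfin]; omega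
  have hpp : (p' : ℝ)⁻¹ = ((2:ℝ≥0):ℝ)⁻¹ - (Module.finrank ℝ (EuclideanSpace ℝ (Fin d)) : ℝ)⁻¹ := by
    rw [hfin, hp', NNReal.coe_ofNat]; field_simp
  have hp2 : 2 ≤ p' := by
    rw [← NNReal.coe_le_coe, hp', NNReal.coe_ofNat, le_div_iff₀ hd2]; linarith
  have hq0 : 0 < q := by linarith
  have hq1 : 0 < q - 1 := by linarith
  set η : ℝ := 1 / (16 * q * ((C:ℝ) ^ 2 + 1)) with hη
  have hη0 : 0 < η := by positivity
  refine ⟨η ^ (1 / (q - 1)), by positivity, ?_⟩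
  intro κ hκ u₁ u₂ hc1 hc2 hg1 hg2 hi1 hi2 hw1 hw2 hbd happ hs1 hs2 hsm
  set S : Set (EuclideanSpace ℝ (Fin d)) := {x | 1 ≤ ‖x‖} with hSdef
  have hSm : MeasurableSet S := measurableSet_le measurable_const measurable_norm
  set μ := (volume : Measure (EuclideanSpace ℝ (Fin d))).restrict S with hμ
  have hae : ∀ᵐ x ∂μ, 1 < ‖x‖ := by
    have h1 : ∀ᵐ x ∂μ, x ∈ S := ae_restrict_mem hSm
    have h2 : ∀ᵐ x ∂μ, x ∉ Metric.sphere (0 : EuclideanSpace ℝ (Fin d)) 1 := by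
      refine ae_restrict_of_ae ?_
      exact measure_eq_zero_iff_ae_notMem.1 (Measure.addHaar_sphere_of_ne_zero _ _ one_ne_zero)
    filter_upwards [h1, h2] with x hx hx2
    exact lt_of_le_of_ne hx (fun h => hx2 (by simp [← h]))
  have hnhd : ∀ x : EuclideanSpace ℝ (Fin d), 1 < ‖x‖ → S ∈ 𝓝 x := fun x hx =>
    mem_of_superset ((isOpen_lt continuous_const continuous_norm).mem_nhds hx)
      (fun y (hy : 1 < ‖y‖) => (hy.le : 1 ≤ ‖y‖))
  have hD1 : ∀ x, 1 < ‖x‖ → DifferentiableAt ℝ u₁ x := fun x hx =>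
    (hc1.contDiffAt (hnhd x hx)).differentiableAt (by norm_num)
  have hD2 : ∀ x, 1 < ‖x‖ → DifferentiableAt ℝ u₂ x := fun x hx =>
    (hc2.contDiffAt (hnhd x hx)).differentiableAt (by norm_num)
  set w : EuclideanSpace ℝ (Fin d) → ℝ := fun x => u₁ x - u₂ x with hw
  have hfw : ∀ x, 1 < ‖x‖ → fderiv ℝ w x = fderiv ℝ u₁ x - fderiv ℝ u₂ x := fun x hx =>
    fderiv_fun_sub (hD1 x hx) (hD2 x hx)
  have hDw : ∀ x, 1 < ‖x‖ → DifferentiableAt ℝ w x := fun x hx => (hD1 x hx).sub (hD2 x hx)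
  have hm1 := memLp_comp d u₁ μ hg1
  have hm2 := memLp_comp d u₂ μ hg2
  have hmw : ∀ a, MemLp (fun x => fderiv ℝ w x (EuclideanSpace.single a 1)) 2 μ := fun a => by
    refine ((hm1 a).sub (hm2 a)).ae_eq ?_
    filter_upwards [hae] with x hx
    simp [hfw x hx]
  have hIw := int_normSq d w μ hmw
  have hwc : ContDiffOn ℝ 1 w S := hc1.sub hc2
  have hwp : IntegrableOn (fun x => |w x| ^ (p':ℝ)) S volume := by
    have hp0 : p' ≠ 0 := by
      intro h; rw [h] at hp2; simp at hp2
    have aux : ∀ u : EuclideanSpace ℝ (Fin d) → ℝ, ContDiffOn ℝ 1 u S →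
        (IntegrableOn (fun x => |u x| ^ (p':ℝ)) S volume ↔ MemLp u p' μ) := by
      intro u hu
      have := integrable_norm_rpow_iff (μ := μ) (p := p') (hu.continuousOn.aestronglyMeasurable hSm)
        (by simpa using hp0) (by simp)
      rw [← this]
      simp [IntegrableOn, hμ]
    rw [aux w hwc]
    exact ((aux u₁ hc1).1 hi1).sub ((aux u₂ hc2).1 hi2)
  have hsob := sobB volume hn p' hpp hp2 w hwc (fun x hx => sub_eq_zero.2 (hbd x hx)) hwp
  set a : ℝ := ∫ x, gradNormSq d w x ∂μ with ha
  have ha0 : 0 ≤ a := integral_nonneg (gradNormSq_nonneg d w)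
  have hsobw : eLpNorm w p' μ ≤ C * ENNReal.ofReal √a := by
    refine hsob.trans ?_
    gcongr
    exact eLp_fderiv_le d w μ hIw
  have hI1 : 0 ≤ ∫ x in S, |u₁ x| ^ ((d : ℝ) * (q - 1) / 2) := integral_nonneg fun x => by positivity
  have hI2 : 0 ≤ ∫ x in S, |u₂ x| ^ ((d : ℝ) * (q - 1) / 2) := integral_nonneg fun x => by positivity
  have hu1 := eLp_pow d hd q hq μ u₁ η hη0 hs1
    (by have := Real.rpow_nonneg hI2 (2 / ((d : ℝ) * (q - 1))); linarith)
  have hu2 := eLp_pow d hd q hq μ u₂ η hη0 hs2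
    (by have := Real.rpow_nonneg hI1 (2 / ((d : ℝ) * (q - 1))); linarith)
  -- the energy vanishes
  have haz : a = 0 := by
    by_contra hane
    have hapos : 0 < a := lt_of_le_of_ne ha0 (Ne.symm hane)
    obtain ⟨φ, hφs, hφc, hφt, hφi⟩ := happ (a / 4) (by positivity)
    have hφ1 : ContDiff ℝ 1 φ := by exact_mod_cast hφs 1
    have hφD : ∀ x, DifferentiableAt ℝ φ x := hφ1.differentiable (by norm_num)
    set ψ : EuclideanSpace ℝ (Fin d) → ℝ := fun y => u₁ y - u₂ y - φ y with hψ
    have hfψ : ∀ x, 1 < ‖x‖ → fderiv ℝ ψ x = fderiv ℝ w x - fderiv ℝ φ x := fun x hx =>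
      fderiv_fun_sub (hDw x hx) (hφD x)
    have hmφ' : ∀ a, MemLp (fun x => fderiv ℝ φ x (EuclideanSpace.single a 1)) 2 volume := fun a => by
      have h1 : Continuous (fun x => fderiv ℝ φ x (EuclideanSpace.single a (1:ℝ))) :=
        (hφ1.continuous_fderiv (by norm_num)).clm_apply continuous_const
      exact h1.memLp_of_hasCompactSupport (hφc.fderiv_apply ℝ _)
    have hmφ : ∀ a, MemLp (fun x => fderiv ℝ φ x (EuclideanSpace.single a 1)) 2 μ := fun a =>
      (hmφ' a).restrict S
    have hmψ : ∀ a, MemLp (fun x => fderiv ℝ ψ x (EuclideanSpace.single a 1)) 2 μ := fun a => by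
      refine ((hmw a).sub (hmφ a)).ae_eq ?_
      filter_upwards [hae] with x hx
      simp [hfψ x hx]
    have hIψ := int_normSq d ψ μ hmψ
    have hIφ := int_normSq d φ μ hmφ
    set c : ℝ := ∫ x, gradNormSq d ψ x ∂μ with hc
    set b : ℝ := ∫ x, gradNormSq d φ x ∂μ with hb
    have hb0 : 0 ≤ b := integral_nonneg (gradNormSq_nonneg d φ)
    have hlt : {x : EuclideanSpace ℝ (Fin d) | 1 < ‖x‖} ⊆ S := fun y (hy : 1 < ‖y‖) => (hy.le : 1 ≤ ‖y‖)
    have hφz : ∀ x, x ∉ S → φ x = 0 := fun x hx => by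
      by_contra h
      exact hx (hlt (hφt (subset_tsupport φ h)))
    have hφzd : ∀ x, x ∉ S → fderiv ℝ φ x = 0 := fun x hx => by
      by_contra h
      exact hx (hlt (hφt (support_fderiv_subset ℝ h)))
    have hsobφ : eLpNorm φ p' μ ≤ C * ENNReal.ofReal √b := by
      calc eLpNorm φ p' μ ≤ eLpNorm φ p' volume := eLpNorm_mono_measure _ Measure.restrict_le_self
        _ ≤ C * eLpNorm (fderiv ℝ φ) 2 volume :=
          eLpNorm_le_eLpNorm_fderiv_of_eq_inner volume hφ1 hφc (p := 2) (by norm_num) hn hpp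
        _ = C * eLpNorm (fderiv ℝ φ) 2 μ := by
          rw [hμ, ← eLpNorm_indicator_eq_eLpNorm_restrict (f := fderiv ℝ φ) hSm,
            Set.indicator_eq_self.2 (fun x hx => by_contra fun h => hx (hφzd x h))]
        _ ≤ _ := by
          gcongr
          exact eLp_fderiv_le d φ μ hIφ
    have hnl := nl_est d hd q hq η hη0 μ p' hp' C √a √b (Real.sqrt_nonneg _) (Real.sqrt_nonneg _) u₁ u₂ φ
      (hc1.continuousOn.aestronglyMeasurable hSm) (hc2.continuousOn.aestronglyMeasurable hSm)
      hφ1.continuous.aestronglyMeasurable hu1 hu2 hsobw hsobφ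
    -- integrability of nonlinear terms
    have hNi : ∀ u : EuclideanSpace ℝ (Fin d) → ℝ, ContDiffOn ℝ 1 u S →
        Integrable (fun x => |u x| ^ (q - 1) * u x * φ x) μ := by
      intro u hu
      refine Integrable.restrict ?_
      have h1 : ContinuousOn (fun x => |u x| ^ (q - 1) * u x * φ x) (tsupport φ) := by
        have h2 : ContinuousOn u (tsupport φ) := hu.continuousOn.mono fun x hx => hlt (hφt hx)
        exact ((h2.abs.rpow_const (fun x _ => Or.inr hq1.le)).mul h2).mul hφ1.continuous.continuousOn
      have h3 := h1.integrableOn_compact hφc (μ := volume)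
      rwa [integrableOn_iff_integrable_of_support_subset] at h3
      intro x hx
      refine subset_tsupport φ ?_
      intro h
      exact hx (by simp [h])
    have e1 := hw1 φ hφs hφc hφt
    have e2 := hw2 φ hφs hφc hφt
    have eN : ∫ x, (|u₁ x| ^ (q-1) * u₁ x - |u₂ x| ^ (q-1) * u₂ x) * φ x ∂μ =
        (∫ x, |u₁ x| ^ (q-1) * u₁ x * φ x ∂μ) - ∫ x, |u₂ x| ^ (q-1) * u₂ x * φ x ∂μ := by
      rw [← integral_sub (hNi u₁ hc1) (hNi u₂ hc2)]
      congr 1; ext x; ring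
    have eD : ∫ x, gradDot d w φ x ∂μ = (∫ x, gradDot d u₁ φ x ∂μ) - ∫ x, gradDot d u₂ φ x ∂μ := by
      rw [← integral_sub (int_dot d u₁ φ μ hm1 hmφ) (int_dot d u₂ φ μ hm2 hmφ)]
      refine integral_congr_ae ?_
      filter_upwards [hae] with x hx
      simp [gradDot, hfw x hx, sub_mul]
    have eW : ∫ x, gradDot d w φ x ∂μ =
        -κ * ∫ x, (|u₁ x| ^ (q-1) * u₁ x - |u₂ x| ^ (q-1) * u₂ x) * φ x ∂μ := by
      rw [eN, eD]; linarith
    have hW : ∫ x, gradDot d w φ x ∂μ ≤ 2 * q * η * C ^ 2 * √a * √b := by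
      refine (le_abs_self _).trans ?_
      rw [eW, abs_mul, abs_neg]
      exact (mul_le_of_le_one_left (abs_nonneg _) hκ).trans hnl
    -- energy inequality
    have hE : a ≤ a / 2 + c / 2 + ∫ x, gradDot d w φ x ∂μ := by
      have hid := int_dot d w φ μ hmw hmφ
      have : a ≤ ∫ x, (gradNormSq d w x / 2 + gradNormSq d ψ x / 2 + gradDot d w φ x) ∂μ := by
        refine integral_mono_ae hIw (((hIw.div_const 2).add (hIψ.div_const 2)).add hid) ?_
        filter_upwards [hae] with x hx
        simp only [gradNormSq, gradDot, hfψ x hx, Finset.sum_div, ← Finset.sum_add_distrib]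
        refine Finset.sum_le_sum fun i _ => ?_
        simp only [sub_apply]
        nlinarith [sq_nonneg (fderiv ℝ φ x (EuclideanSpace.single i 1))]
      have hadd : Integrable (fun x => gradNormSq d w x / 2 + gradNormSq d ψ x / 2) μ :=
        (hIw.div_const 2).add (hIψ.div_const 2)
      rwa [integral_add hadd hid,
        integral_add (hIw.div_const 2) (hIψ.div_const 2), integral_div, integral_div] at this
    have hB : b ≤ 2 * a + 2 * c := by
      have : b ≤ ∫ x, (2 * gradNormSq d w x + 2 * gradNormSq d ψ x) ∂μ := by
        refine integral_mono_ae hIφ ((hIw.const_mul 2).add (hIψ.const_mul 2)) ?_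
        filter_upwards [hae] with x hx
        simp only [gradNormSq, hfψ x hx, Finset.mul_sum, ← Finset.sum_add_distrib]
        refine Finset.sum_le_sum fun i _ => ?_
        simp only [sub_apply]
        nlinarith [sq_nonneg (2 * fderiv ℝ w x (EuclideanSpace.single i 1) - fderiv ℝ φ x (EuclideanSpace.single i 1))]
      rwa [integral_add (hIw.const_mul 2) (hIψ.const_mul 2), integral_const_mul, integral_const_mul] at this
    have hfin := fin_est q hq0 C a b ha0 hb0
    rw [← hη] at hfin
    linarith
  rw [haz] at hsobw
  have hz : eLpNorm w p' μ = 0 := by simpa using hsobw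
  rw [eLpNorm_eq_zero_iff (hwc.continuousOn.aestronglyMeasurable hSm)
    (by intro h; have : p' = 0 := by exact_mod_cast h
        rw [this] at hp2; simp at hp2)] at hz
  intro x hx
  rcases lt_or_eq_of_le hx with h | h
  · have hU : IsOpen {x : EuclideanSpace ℝ (Fin d) | 1 < ‖x‖} := isOpen_lt continuous_const continuous_norm
    have hsub : {x : EuclideanSpace ℝ (Fin d) | 1 < ‖x‖} ⊆ S := fun y (hy : 1 < ‖y‖) => (hy.le : 1 ≤ ‖y‖)
    have := Measure.eqOn_open_of_ae_eq (μ := volume) (ae_restrict_of_ae_restrict_of_subset hsub hz) hU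
      (hwc.continuousOn.mono hsub) continuousOn_const
    have := this h
    simpa [hw, sub_eq_zero] using this
  · exact hbd x h.symm
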